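/- arXiv:2109.01477 — 2 statements merged into one kernel-verified Lean document; each statement's English description precedes it below -/
import Mathlib

section
/- The modified gamma function at 1 equals π/2: that is, exp(γ̃₀) · lim_{N→∞} ∏_{m=1}^{N} (exp(−1/m)·(1+1/m))^{(−1)^{m+1}} = π/2, where the limit exists. Equivalently, Γ̃(1) = π/2. -/
open Filter Finset Topology

/-- The modified Euler constant `γ̃₀ = 1/2 + (1/2)·∑_{j=1}^∞ (−1)^{j+1}/(j(j+1))`
(reindexed over `j : ℕ` starting at `0`). -/
noncomputable def gammaTilde0 : ℝ :=
  1 / 2 + (1 / 2) * ∑' j : ℕ, (-1 : ℝ) ^ j / ((j + 1) * (j + 2))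

/-- The modified gamma function
`Γ̃(z) = z⁻¹ · exp(γ̃₀ z) · lim_{N→∞} ∏_{m=1}^N (exp(−z/m)(1+z/m))^{(−1)^{m+1}}`. -/
noncomputable def gammaTilde (z : ℂ) : ℂ :=
  z⁻¹ * Complex.exp ((gammaTilde0 : ℂ) * z) *
    limUnder atTop (fun N : ℕ =>
      ∏ m ∈ Finset.Icc 1 N,
        (Complex.exp (-z / (m : ℂ)) * (1 + z / (m : ℂ))) ^ ((-1 : ℤ) ^ (m + 1)))

theorem gammaTilde0_partialSum (n : ℕ) :
    1 / 2 + (1 / 2) * ∑ j ∈ range n, (-1 : ℝ) ^ j / ((j + 1) * (j + 2)) =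
      ∑ j ∈ range n, (-1 : ℝ) ^ j / (j + 1) + (-1) ^ n / (2 * (n + 1)) := by
  induction n with
  | zero => norm_num
  | succ n ih =>
    rw [sum_range_succ, sum_range_succ, mul_add, ← add_assoc, ih, pow_succ]
    push_cast
    have h₁ : (n : ℝ) + 1 ≠ 0 := by positivity
    have h₂ : (n : ℝ) + 2 ≠ 0 := by positivity
    have h₃ : (n : ℝ) + 1 + 1 ≠ 0 := by positivity
    field_simp
    ring

theorem summable_gammaTilde0 :
    Summable fun j : ℕ => (-1 : ℝ) ^ j / ((j + 1) * (j + 2)) := by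
  have h : Summable fun j : ℕ => 1 / ((j + 1 : ℕ) : ℝ) ^ 2 :=
    (summable_nat_add_iff 1).2 (Real.summable_one_div_nat_pow.2 one_lt_two)
  refine h.of_norm_bounded fun j => ?_
  rw [norm_div, norm_pow, norm_neg, norm_one, one_pow, Real.norm_of_nonneg (by positivity)]
  push_cast
  gcongr
  nlinarith [(Nat.cast_nonneg j : (0 : ℝ) ≤ j)]

/-- The alternating harmonic series converges to `γ̃₀`. -/
theorem tendsto_alternating_harmonic_gammaTilde0 :
    Tendsto (fun n : ℕ => ∑ j ∈ range n, (-1 : ℝ) ^ j / (j + 1)) atTop (𝓝 gammaTilde0) := by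
  have h₁ : Tendsto (fun n : ℕ => (-1 : ℝ) ^ n / (2 * (n + 1))) atTop (𝓝 0) := by
    refine squeeze_zero_norm (fun n => ?_) tendsto_one_div_add_atTop_nhds_zero_nat
    rw [norm_div, norm_pow, norm_neg, norm_one, one_pow, Real.norm_of_nonneg (by positivity)]
    gcongr
    linarith [(Nat.cast_nonneg n : (0 : ℝ) ≤ n)]
  have h₂ := ((summable_gammaTilde0.hasSum.tendsto_sum_nat.const_mul (1 / 2)).const_add
    (1 / 2)).sub h₁
  rw [sub_zero] at h₂
  refine h₂.congr fun n => ?_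
  rw [gammaTilde0_partialSum, add_sub_cancel_right]

theorem prod_range_two_mul_eq_wallis (k : ℕ) :
    ∏ i ∈ range (2 * k), (1 + 1 / ((i : ℝ) + 1)) ^ ((-1 : ℤ) ^ i) = Real.Wallis.W k := by
  induction k with
  | zero => simp [Real.Wallis.W]
  | succ k ih =>
    rw [Nat.mul_succ, prod_range_succ, prod_range_succ, ih, Real.Wallis.W_succ, mul_assoc]
    have he : (-1 : ℤ) ^ (2 * k) = 1 := by simp
    have ho : (-1 : ℤ) ^ (2 * k + 1) = -1 := by simp [pow_succ]
    rw [he, ho, zpow_one, zpow_neg_one]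
    push_cast
    congr 1
    field_simp
    ring

/-- Wallis' product, with the partial products taken one factor at a time. -/
theorem tendsto_prod_range_pi_div_two :
    Tendsto (fun n : ℕ => ∏ i ∈ range n, (1 + 1 / ((i : ℝ) + 1)) ^ ((-1 : ℤ) ^ i)) atTop
      (𝓝 (Real.pi / 2)) := by
  have hW : Tendsto (fun n : ℕ => Real.Wallis.W (n / 2)) atTop (𝓝 (Real.pi / 2)) :=
    Real.Wallis.tendsto_W_nhds_pi_div_two.comp (Nat.tendsto_div_const_atTop two_ne_zero)
  have hU : Tendsto (fun n : ℕ => Real.Wallis.W (n / 2) * (1 + 1 / (n : ℝ))) atTop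
      (𝓝 (Real.pi / 2)) := by
    simpa using hW.mul (tendsto_one_div_atTop_nhds_zero_nat.const_add (1 : ℝ))
  refine tendsto_of_tendsto_of_tendsto_of_le_of_le hW hU (fun n => ?_) fun n => ?_ <;>
  · have hpos := Real.Wallis.W_pos (n / 2)
    have hn : (0 : ℝ) ≤ 1 / (n : ℝ) := by positivity
    obtain ⟨k, rfl | rfl⟩ := Nat.even_or_odd' n
    · rw [Nat.mul_div_cancel_left k two_pos] at hpos ⊢
      nlinarith [prod_range_two_mul_eq_wallis k]
    · rw [prod_range_succ, prod_range_two_mul_eq_wallis]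
      have hk : (2 * k + 1) / 2 = k := by omega
      rw [hk] at hpos ⊢
      push_cast at hn ⊢
      simp only [even_two, Even.mul_right, Even.neg_pow, one_pow, zpow_one]
      nlinarith

theorem prod_gammaTilde_one_eq (N : ℕ) :
    ∏ m ∈ Icc 1 N,
        (Complex.exp (-1 / (m : ℂ)) * (1 + 1 / (m : ℂ))) ^ ((-1 : ℤ) ^ (m + 1)) =
      ((Real.exp (-∑ j ∈ range N, (-1 : ℝ) ^ j / (j + 1)) *
        ∏ i ∈ range N, (1 + 1 / ((i : ℝ) + 1)) ^ ((-1 : ℤ) ^ i) : ℝ) : ℂ) := by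
  induction N with
  | zero => simp
  | succ N ih =>
    rw [prod_Icc_succ_top (by omega), ih, sum_range_succ, prod_range_succ, neg_add, Real.exp_add]
    have hpow : (-1 : ℤ) ^ (N + 1 + 1) = (-1) ^ N := by ring
    have hterm : Real.exp (-((-1 : ℝ) ^ N / (N + 1))) =
        Real.exp (-1 / ((N : ℝ) + 1)) ^ ((-1 : ℤ) ^ N) := by
      rw [← Real.rpow_intCast, ← Real.exp_mul]
      push_cast
      congr 1
      ring
    rw [hpow, hterm, mul_zpow]
    push_cast
    ring

theorem tendsto_prod_gammaTilde_one :
    Tendsto (fun N : ℕ => ∏ m ∈ Icc 1 N,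
        (Complex.exp (-1 / (m : ℂ)) * (1 + 1 / (m : ℂ))) ^ ((-1 : ℤ) ^ (m + 1)))
      atTop (𝓝 ((Real.exp (-gammaTilde0) * (Real.pi / 2) : ℝ) : ℂ)) := by
  simp_rw [prod_gammaTilde_one_eq]
  exact (Complex.continuous_ofReal.tendsto _).comp
    (((Real.continuous_exp.tendsto _).comp tendsto_alternating_harmonic_gammaTilde0.neg).mul
      tendsto_prod_range_pi_div_two)

/-- `Γ̃(1) = π/2`: the limit `L` of the partial products
`∏_{m=1}^N (exp(−1/m)(1+1/m))^{(−1)^{m+1}}` exists and `exp(γ̃₀)·L = π/2`;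
equivalently, the modified gamma function satisfies `Γ̃(1) = π/2`. -/
theorem gammaTilde_one :
    (∃ L : ℂ, Tendsto (fun N : ℕ =>
        ∏ m ∈ Finset.Icc 1 N,
          (Complex.exp (-1 / (m : ℂ)) * (1 + 1 / (m : ℂ))) ^ ((-1 : ℤ) ^ (m + 1)))
        atTop (𝓝 L) ∧
      Complex.exp ((gammaTilde0 : ℝ) : ℂ) * L = ((Real.pi / 2 : ℝ) : ℂ)) ∧
    gammaTilde 1 = ((Real.pi / 2 : ℝ) : ℂ) := by
  have hval : Complex.exp ((gammaTilde0 : ℝ) : ℂ) *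
      ((Real.exp (-gammaTilde0) * (Real.pi / 2) : ℝ) : ℂ) = ((Real.pi / 2 : ℝ) : ℂ) := by
    rw [← Complex.ofReal_exp, ← Complex.ofReal_mul, ← mul_assoc, ← Real.exp_add,
      add_neg_cancel, Real.exp_zero, one_mul]
  refine ⟨⟨_, tendsto_prod_gammaTilde_one, hval⟩, ?_⟩
  rw [gammaTilde, tendsto_prod_gammaTilde_one.limUnder_eq, inv_one, one_mul, mul_one, hval]
end

section
/- Existence of analytic continuation of the alternating zeta-product series: let n ≥ 1 and let z₁,…,zₙ be complex numbers, none of which is a nonpositive integer. The series Λ*(s) = ∑_{m=0}^∞ (−1)^{m+1} ∏_{j=1}^n (m+z_j)^{−s} converges for Re(s) > 0, and there exists a function F analytic on the half-plane {s ∈ ℂ : Re(s) > −1/n} such that F(s) = Λ*(s) for all s with Re(s) > 0. -/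
open Filter Finset Topology

/-- A second difference with unit step is bounded by any bound for the second derivative. -/
lemma norm_second_difference_le {h h' h'' : ℝ → ℂ} {a C : ℝ}
    (hh : ∀ t, a ≤ t → HasDerivAt h (h' t) t) (hh' : ∀ t, a ≤ t → HasDerivAt h' (h'' t) t)
    (hC : ∀ t, a ≤ t → ‖h'' t‖ ≤ C) :
    ‖h a - 2 * h (a + 1) + h (a + 2)‖ ≤ C := by
  have first : ∀ t, a ≤ t → ‖h' (t + 1) - h' t‖ ≤ C := by
    intro t ht
    have := (convex_Ici a).norm_image_sub_le_of_norm_hasDerivWithin_le (f := h') (f' := h'')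
      (fun x hx => (hh' x hx).hasDerivWithinAt) (fun x hx => hC x hx) (Set.mem_Ici.2 ht)
      (Set.mem_Ici.2 (by linarith : a ≤ t + 1))
    simpa using this
  have second := (convex_Ici a).norm_image_sub_le_of_norm_hasDerivWithin_le
    (f := fun t => h (t + 1) - h t) (f' := fun t => h' (t + 1) - h' t)
    (fun x hx => (((hh (x + 1) (by have := Set.mem_Ici.1 hx; linarith)).comp_add_const x 1).sub
      (hh x hx)).hasDerivWithinAt)
    (fun x hx => first x hx) (Set.mem_Ici.2 le_rfl) (Set.mem_Ici.2 (by linarith : a ≤ a + 1))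
  have e : a + 1 + 1 = a + 2 := by ring
  simp only [e, add_sub_cancel_left, norm_one, mul_one] at second
  refine le_of_eq_of_le (congrArg norm ?_) second
  ring

lemma one_add_le_norm_add {w : ℂ} (hw : 1 ≤ w.re) (t : ℝ) : 1 + t ≤ ‖(t : ℂ) + w‖ := by
  refine le_trans ?_ (Complex.re_le_norm _)
  simp only [Complex.add_re, Complex.ofReal_re]
  linarith

lemma norm_cpow_neg_le {w s : ℂ} (hw : w ≠ 0) :
    ‖w ^ (-s)‖ ≤ ‖w‖ ^ (-s.re) * Real.exp (Real.pi * ‖s‖) := by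
  rw [Complex.norm_cpow_of_ne_zero hw, div_eq_mul_inv, ← Real.exp_neg]
  simp only [Complex.neg_re, Complex.neg_im]
  gcongr
  calc -(w.arg * -s.im) = w.arg * s.im := by ring
    _ ≤ |w.arg * s.im| := le_abs_self _
    _ = |w.arg| * |s.im| := abs_mul _ _
    _ ≤ Real.pi * ‖s‖ := by
      gcongr
      · exact Complex.abs_arg_le_pi w
      · exact Complex.abs_im_le_norm s

lemma tendsto_natCast_add_cpow_neg {w s : ℂ} (hw : 1 ≤ w.re) (hs : 0 < s.re) :
    Tendsto (fun N : ℕ => ((N : ℂ) + w) ^ (-s)) atTop (𝓝 0) := by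
  have lim : Tendsto (fun N : ℕ => (1 + (N : ℝ)) ^ (-s.re) * Real.exp (Real.pi * ‖s‖))
      atTop (𝓝 0) := by
    have := ((tendsto_rpow_neg_atTop hs).comp
      (tendsto_atTop_add_const_left _ (1 : ℝ) (tendsto_natCast_atTop_atTop (R := ℝ)))).mul_const
      (Real.exp (Real.pi * ‖s‖))
    simpa using this
  refine squeeze_zero_norm (fun N => ?_) lim
  have low := one_add_le_norm_add hw (N : ℝ)
  simp only [Complex.ofReal_natCast] at low
  have pos : (0 : ℝ) < 1 + N := by positivity
  refine (norm_cpow_neg_le (norm_pos_iff.1 (pos.trans_le low))).trans ?_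
  gcongr ?_ * _
  exact Real.rpow_le_rpow_of_nonpos pos low (by linarith)

lemma add_mem_slitPlane {w : ℂ} (hw : 1 ≤ w.re) {t : ℝ} (ht : 0 ≤ t) :
    (t : ℂ) + w ∈ Complex.slitPlane := by
  left
  simp only [Complex.add_re, Complex.ofReal_re]
  linarith

lemma prod_cpow_eq_exp {n : ℕ} {z : Fin n → ℂ} (hz : ∀ j, 1 ≤ (z j).re) (s : ℂ) {t : ℝ}
    (ht : 0 ≤ t) :
    ∏ j, ((t : ℂ) + z j) ^ (-s) = Complex.exp (-s * ∑ j, Complex.log ((t : ℂ) + z j)) := by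
  rw [Finset.mul_sum, Complex.exp_sum]
  refine Finset.prod_congr rfl fun j _ => ?_
  rw [Complex.cpow_def_of_ne_zero (Complex.slitPlane_ne_zero (add_mem_slitPlane (hz j) ht)),
    mul_comm]

/-- The product `∏ (t + z j) ^ (-s)` grows at most like `(1 + t) ^ (a n)` when `-a ≤ Re s`. -/
lemma norm_prod_cpow_le {n : ℕ} {z : Fin n → ℂ} (hz : ∀ j, 1 ≤ (z j).re) {K a B : ℝ}
    (hK : 1 ≤ K) (hzK : ∀ j, ‖z j‖ ≤ K) (ha : 0 ≤ a) {s : ℂ} (hs : -a ≤ s.re) (hB : ‖s‖ ≤ B)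
    {t : ℝ} (ht : 0 ≤ t) :
    ‖∏ j, ((t : ℂ) + z j) ^ (-s)‖ ≤
      (K ^ a * Real.exp (Real.pi * B)) ^ n * (1 + t) ^ (a * n) := by
  have factor : ∀ j, ‖((t : ℂ) + z j) ^ (-s)‖ ≤
      (K ^ a * Real.exp (Real.pi * B)) * (1 + t) ^ a := by
    intro j
    have low := one_add_le_norm_add (hz j) t
    have up : ‖(t : ℂ) + z j‖ ≤ K * (1 + t) := by
      refine (norm_add_le _ _).trans ?_
      rw [Complex.norm_real, Real.norm_of_nonneg ht]
      nlinarith [hzK j]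
    calc ‖((t : ℂ) + z j) ^ (-s)‖
        ≤ ‖(t : ℂ) + z j‖ ^ (-s.re) * Real.exp (Real.pi * ‖s‖) :=
          norm_cpow_neg_le (norm_pos_iff.1 (by linarith))
      _ ≤ (K * (1 + t)) ^ a * Real.exp (Real.pi * B) := by
          gcongr
          refine (Real.rpow_le_rpow_of_exponent_le (by linarith) (by linarith : -s.re ≤ a)).trans ?_
          exact Real.rpow_le_rpow (norm_nonneg _) up ha
      _ = _ := by
          rw [Real.mul_rpow (by linarith) (by linarith)]
          ring
  rw [norm_prod]
  refine (Finset.prod_le_prod (fun _ _ => norm_nonneg _) fun j _ => factor j).trans_eq ?_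
  rw [Finset.prod_const, Finset.card_univ, Fintype.card_fin, mul_pow,
    Real.rpow_mul_natCast (by linarith)]

lemma norm_second_difference_prod_cpow_le {n : ℕ} {z : Fin n → ℂ} (hz : ∀ j, 1 ≤ (z j).re)
    {K a B : ℝ} (hK : 1 ≤ K) (hzK : ∀ j, ‖z j‖ ≤ K) (ha : 0 ≤ a) (han : a * n < 1) {s : ℂ}
    (hs : -a ≤ s.re) (hB : ‖s‖ ≤ B) (m : ℕ) :
    ‖∏ j, ((m : ℂ) + z j) ^ (-s) - 2 * ∏ j, (((m + 1 : ℕ) : ℂ) + z j) ^ (-s)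
        + ∏ j, (((m + 2 : ℕ) : ℂ) + z j) ^ (-s)‖ ≤
      ((B * n) ^ 2 + B * n) * (K ^ a * Real.exp (Real.pi * B)) ^ n *
        (1 + (m : ℝ)) ^ (a * n - 2) := by
  set h : ℝ → ℂ := fun t => Complex.exp (-s * ∑ j, Complex.log ((t : ℂ) + z j)) with h_def
  set p : ℝ → ℂ := fun t => ∑ j, ((t : ℂ) + z j)⁻¹
  set q : ℝ → ℂ := fun t => ∑ j, -(((t : ℂ) + z j) ^ 2)⁻¹
  have shift : ∀ (j : Fin n) (t : ℝ), HasDerivAt (fun t : ℝ => (t : ℂ) + z j) 1 t := fun j t =>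
    (Complex.ofRealCLM.hasDerivAt (x := t)).add_const (z j)
  have deriv_h : ∀ t, 0 ≤ t → HasDerivAt h (h t * (-s * p t)) t := by
    intro t ht
    refine HasDerivAt.cexp (HasDerivAt.const_mul _ (HasDerivAt.fun_sum fun j _ => ?_))
    simpa using (shift j t).clog_real (add_mem_slitPlane (hz j) ht)
  have deriv_p : ∀ t, 0 ≤ t → HasDerivAt p (q t) t := by
    intro t ht
    refine HasDerivAt.fun_sum fun j _ => ?_
    have := (shift j t).fun_inv (Complex.slitPlane_ne_zero (add_mem_slitPlane (hz j) ht))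
    simpa [neg_div] using this
  have bound_p : ∀ t, 0 ≤ t → ‖p t‖ ≤ n * (1 + t)⁻¹ := by
    intro t ht
    refine (norm_sum_le_of_le _ (f := fun j => ((t : ℂ) + z j)⁻¹) (n := fun _ => (1 + t)⁻¹)
      fun j _ => ?_).trans_eq (by simp)
    rw [norm_inv]
    exact inv_anti₀ (by linarith) (one_add_le_norm_add (hz j) t)
  have bound_q : ∀ t, 0 ≤ t → ‖q t‖ ≤ n * ((1 + t) ^ 2)⁻¹ := by
    intro t ht
    refine (norm_sum_le_of_le _ (f := fun j => -(((t : ℂ) + z j) ^ 2)⁻¹)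
      (n := fun _ => ((1 + t) ^ 2)⁻¹) fun j _ => ?_).trans_eq (by simp)
    rw [norm_neg, norm_inv, norm_pow]
    have := one_add_le_norm_add (hz j) t
    gcongr
  have B_nonneg : 0 ≤ B := (norm_nonneg s).trans hB
  have bound_h : ∀ t, 0 ≤ t →
      ‖h t‖ ≤ (K ^ a * Real.exp (Real.pi * B)) ^ n * (1 + t) ^ (a * n) := by
    intro t ht
    simp only [h_def]
    rw [← prod_cpow_eq_exp hz s ht]
    exact norm_prod_cpow_le hz hK hzK ha hs hB ht
  have m_nonneg : (0 : ℝ) ≤ m := m.cast_nonneg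
  have key := norm_second_difference_le (h := h) (h' := fun t => h t * (-s * p t))
    (h'' := fun t => h t * (-s * p t) * (-s * p t) + h t * (-s * q t)) (a := m)
    (C := ((B * n) ^ 2 + B * n) * (K ^ a * Real.exp (Real.pi * B)) ^ n *
        (1 + (m : ℝ)) ^ (a * n - 2))
    (fun t ht => deriv_h t (m_nonneg.trans ht))
    (fun t ht => (deriv_h t (m_nonneg.trans ht)).mul
      ((deriv_p t (m_nonneg.trans ht)).const_mul (-s))) ?_
  · have eval : ∀ k : ℕ, ∏ j, ((k : ℂ) + z j) ^ (-s) = h k := fun k => by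
      simp only [h_def]
      rw [← prod_cpow_eq_exp hz s k.cast_nonneg, Complex.ofReal_natCast]
    rw [eval, eval, eval]
    push_cast
    exact key
  · intro t ht
    have t_nonneg := m_nonneg.trans ht
    have t_pos : 0 < 1 + t := by linarith
    have hp : ‖-s * p t‖ ≤ B * (n * (1 + t)⁻¹) := by
      rw [norm_mul, norm_neg]
      exact mul_le_mul hB (bound_p t t_nonneg) (norm_nonneg _) B_nonneg
    have hq : ‖-s * q t‖ ≤ B * (n * ((1 + t) ^ 2)⁻¹) := by
      rw [norm_mul, norm_neg]
      exact mul_le_mul hB (bound_q t t_nonneg) (norm_nonneg _) B_nonneg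
    set D := (K ^ a * Real.exp (Real.pi * B)) ^ n
    have D_nonneg : 0 ≤ D := by positivity
    calc ‖h t * (-s * p t) * (-s * p t) + h t * (-s * q t)‖
        ≤ ‖h t‖ * ‖-s * p t‖ * ‖-s * p t‖ + ‖h t‖ * ‖-s * q t‖ := by
          refine (norm_add_le _ _).trans_eq ?_
          rw [norm_mul (h t * _), norm_mul (h t), norm_mul (h t)]
      _ ≤ (D * (1 + t) ^ (a * n)) * (B * (n * (1 + t)⁻¹)) * (B * (n * (1 + t)⁻¹)) +
          (D * (1 + t) ^ (a * n)) * (B * (n * ((1 + t) ^ 2)⁻¹)) := by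
          have := bound_h t t_nonneg
          gcongr
      _ = ((B * n) ^ 2 + B * n) * D * (1 + t) ^ (a * n - 2) := by
          rw [Real.rpow_sub t_pos, Real.rpow_two]
          field_simp
      _ ≤ _ := by
          gcongr ?_ * ?_
          exact Real.rpow_le_rpow_of_nonpos (by linarith) (by linarith) (by linarith)

/-- Euler's transformation of an alternating sum, applied twice. -/
lemma sum_alternating_second_difference (f : ℕ → ℂ) (N : ℕ) :
    ∑ m ∈ range N, (-1 : ℂ) ^ (m + 1) * (f m - 2 * f (m + 1) + f (m + 2)) =
      4 * ∑ m ∈ range N, (-1 : ℂ) ^ (m + 1) * f m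
        + (-1) ^ (N + 1) * (3 * f N - f (N + 1)) + (3 * f 0 - f 1) := by
  induction N with
  | zero => simp
  | succ N ih =>
    rw [Finset.sum_range_succ, Finset.sum_range_succ, ih]
    ring

lemma differentiable_prod_cpow_neg {n : ℕ} {w : Fin n → ℂ} (hw : ∀ j, w j ≠ 0) :
    Differentiable ℂ fun s : ℂ => ∏ j, w j ^ (-s) :=
  Differentiable.fun_finsetProd fun j _ =>
    differentiable_neg.const_cpow (Or.inl (hw j))

lemma exists_continuation_of_one_le_re {n : ℕ} (hn : 1 ≤ n) {z : Fin n → ℂ}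
    (hz : ∀ j, 1 ≤ (z j).re) :
    ∃ F : ℂ → ℂ, DifferentiableOn ℂ F {s : ℂ | -(1 / (n : ℝ)) < s.re} ∧
      ∀ s : ℂ, 0 < s.re →
        Tendsto (fun N : ℕ => ∑ m ∈ range N,
          (-1 : ℂ) ^ (m + 1) * ∏ j, ((m : ℂ) + z j) ^ (-s)) atTop (𝓝 (F s)) := by
  set f : ℕ → ℂ → ℂ := fun m s => ∏ j, ((m : ℂ) + z j) ^ (-s) with f_def
  set d : ℕ → ℂ → ℂ := fun m s =>
    (-1 : ℂ) ^ (m + 1) * (f m s - 2 * f (m + 1) s + f (m + 2) s) with d_def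
  have n_pos : (0 : ℝ) < n := by exact_mod_cast hn
  have f_diff : ∀ m, Differentiable ℂ (f m) := by
    refine fun m => differentiable_prod_cpow_neg fun j => ?_
    have := Complex.slitPlane_ne_zero (add_mem_slitPlane (hz j) (m.cast_nonneg (α := ℝ)))
    simpa using this
  have d_diff : ∀ m, Differentiable ℂ (d m) := fun m =>
    (((f_diff m).sub ((f_diff (m + 1)).const_mul 2)).add (f_diff (m + 2))).const_mul _
  have majorant : ∀ s : ℂ, -(1 / (n : ℝ)) < s.re → ∃ u : ℕ → ℝ, Summable u ∧
      ∃ U : Set ℂ, IsOpen U ∧ s ∈ U ∧ ∀ m, ∀ w ∈ U, ‖d m w‖ ≤ u m := by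
    intro s hs
    obtain ⟨a, ha, ha'⟩ := exists_between (max_lt (by linarith : -s.re < 1 / (n : ℝ))
      (by positivity : (0 : ℝ) < 1 / n))
    have a_nonneg : 0 ≤ a := (le_max_right _ _).trans ha.le
    have han : a * n < 1 := (lt_div_iff₀ n_pos).1 ha'
    set K : ℝ := 1 + ∑ j, ‖z j‖
    have hK : 1 ≤ K := le_add_of_nonneg_right (Finset.sum_nonneg fun _ _ => norm_nonneg _)
    have hzK : ∀ j, ‖z j‖ ≤ K := fun j =>
      (Finset.single_le_sum (f := fun j => ‖z j‖) (fun _ _ => norm_nonneg _)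
        (Finset.mem_univ j)).trans (by linarith)
    refine ⟨fun m => (((‖s‖ + 1) * n) ^ 2 + (‖s‖ + 1) * n) *
      (K ^ a * Real.exp (Real.pi * (‖s‖ + 1))) ^ n * (1 + (m : ℝ)) ^ (a * n - 2), ?_,
      {w : ℂ | -a < w.re} ∩ {w : ℂ | ‖w‖ < ‖s‖ + 1},
      (isOpen_lt continuous_const Complex.continuous_re).inter
        (isOpen_lt continuous_norm continuous_const),
      ⟨by have := (le_max_left _ _).trans_lt ha; simp only [Set.mem_ofPred_eq]; linarith,
        by simp⟩, ?_⟩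
    · refine Summable.mul_left _ ?_
      have := (summable_nat_add_iff 1).2
        (Real.summable_nat_rpow.2 (by linarith : a * n - 2 < -1))
      simpa [add_comm] using this
    · rintro m w ⟨hw, hw'⟩
      rw [d_def, norm_mul, norm_pow, norm_neg, norm_one, one_pow, one_mul]
      exact norm_second_difference_prod_cpow_le hz hK hzK a_nonneg han hw.le hw'.le m
  refine ⟨fun s => (∑' m, d m s - (3 * f 0 s - f 1 s)) / 4, ?_, ?_⟩
  · intro s hs
    obtain ⟨u, hu, U, hU, hsU, hdU⟩ := majorant s hs
    have tsum_diff : DifferentiableAt ℂ (fun s => ∑' m, d m s) s :=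
      (Complex.differentiableOn_tsum_of_summable_norm hu
        (fun m => (d_diff m).differentiableOn) hU hdU).differentiableAt (hU.mem_nhds hsU)
    exact ((tsum_diff.sub (((f_diff 0 s).const_mul 3).sub (f_diff 1 s))).div_const
      4).differentiableWithinAt
  · intro s hs
    obtain ⟨u, hu, U, -, hsU, hdU⟩ := majorant s (lt_trans (by simpa using n_pos) hs)
    have lim_d := (Summable.of_norm_bounded hu fun m => hdU m s hsU).hasSum.tendsto_sum_nat
    have lim_f : Tendsto (fun N => f N s) atTop (𝓝 0) := by
      have := tendsto_finsetProd univ fun j _ => tendsto_natCast_add_cpow_neg (hz j) hs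
      simpa [f_def, Finset.prod_const, zero_pow (by omega : n ≠ 0)] using this
    have lim_boundary : Tendsto
        (fun N => (-1 : ℂ) ^ (N + 1) * (3 * f N s - f (N + 1) s)) atTop (𝓝 0) := by
      rw [tendsto_zero_iff_norm_tendsto_zero]
      have := ((lim_f.const_mul 3).sub (lim_f.comp (tendsto_add_atTop_nat 1))).norm
      simpa using this
    have lim := ((lim_d.sub lim_boundary).sub_const (3 * f 0 s - f 1 s)).div_const 4
    rw [sub_zero] at lim
    refine lim.congr fun N => ?_
    rw [sum_alternating_second_difference fun m => f m s]
    ring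

/-- Existence of analytic continuation: for `z₁,…,zₙ` none a nonpositive integer, the
series `Λ*(s) = ∑_{m=0}^∞ (−1)^{m+1} ∏_{j=1}^n (m+z_j)^{−s}` converges for `Re(s) > 0`
and there is `F` analytic on `{Re(s) > −1/n}` with `F(s) = Λ*(s)` for `Re(s) > 0`. -/
theorem alt_zeta_product_continuation (n : ℕ) (hn : 1 ≤ n) (z : Fin n → ℂ)
    (hz : ∀ j, ∀ k : ℕ, z j ≠ -(k : ℂ)) :
    (∀ s : ℂ, 0 < s.re → ∃ L : ℂ,
      Tendsto (fun N : ℕ => ∑ m ∈ Finset.range N,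
        (-1 : ℂ) ^ (m + 1) * ∏ j, ((m : ℂ) + z j) ^ (-s)) atTop (𝓝 L)) ∧
    (∃ F : ℂ → ℂ, AnalyticOnNhd ℂ F {s : ℂ | -(1 / (n : ℝ)) < s.re} ∧
      ∀ s : ℂ, 0 < s.re →
        Tendsto (fun N : ℕ => ∑ m ∈ Finset.range N,
          (-1 : ℂ) ^ (m + 1) * ∏ j, ((m : ℂ) + z j) ^ (-s)) atTop (𝓝 (F s))) := by
  obtain ⟨M, hM⟩ : ∃ M : ℕ, ∀ j, 1 ≤ ((M : ℂ) + z j).re := by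
    obtain ⟨M, hM⟩ := exists_nat_ge (1 + ∑ j, ‖z j‖)
    refine ⟨M, fun j => ?_⟩
    have h₁ := Finset.single_le_sum (f := fun j => ‖z j‖) (fun _ _ => norm_nonneg _)
      (Finset.mem_univ j)
    have h₂ := neg_le_of_abs_le (Complex.abs_re_le_norm (z j))
    simp only [Complex.add_re, Complex.natCast_re]
    linarith
  obtain ⟨G, G_diff, G_lim⟩ := exists_continuation_of_one_le_re hn hM
  have continuation : ∃ F : ℂ → ℂ, AnalyticOnNhd ℂ F {s : ℂ | -(1 / (n : ℝ)) < s.re} ∧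
      ∀ s : ℂ, 0 < s.re →
        Tendsto (fun N : ℕ => ∑ m ∈ Finset.range N,
          (-1 : ℂ) ^ (m + 1) * ∏ j, ((m : ℂ) + z j) ^ (-s)) atTop (𝓝 (F s)) := by
    refine ⟨fun s => ∑ m ∈ range M, (-1 : ℂ) ^ (m + 1) * ∏ j, ((m : ℂ) + z j) ^ (-s)
      + (-1) ^ M * G s, ?_, fun s hs => ?_⟩
    · refine DifferentiableOn.analyticOnNhd ?_ (isOpen_lt continuous_const Complex.continuous_re)
      refine DifferentiableOn.fun_add (Differentiable.differentiableOn ?_) (G_diff.const_mul _)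
      refine Differentiable.fun_sum fun m _ =>
        (differentiable_prod_cpow_neg fun j h => ?_).const_mul _
      exact hz j m (eq_neg_of_add_eq_zero_right h)
    · rw [← tendsto_add_atTop_iff_nat M]
      refine (((G_lim s hs).const_mul ((-1 : ℂ) ^ M)).const_add _).congr fun N => ?_
      rw [add_comm N M, Finset.sum_range_add, Finset.mul_sum]
      congr 1
      refine Finset.sum_congr rfl fun m _ => ?_
      have shift : ∀ j, ((M + m : ℕ) : ℂ) + z j = (m : ℂ) + ((M : ℂ) + z j) := fun j => by
        push_cast
        ring
      simp only [shift]
      ring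
  obtain ⟨F, F_analytic, F_lim⟩ := continuation
  exact ⟨fun s hs => ⟨F s, F_lim s hs⟩, F, F_analytic, F_lim⟩
end
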